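/- For every integer m ≥ 3, the Cartesian product C_m □ P_2 (the prism over the m-cycle) satisfies tndi(C_m □ P_2) = 5 = Δ + 2, where Δ = 3 is its maximum degree. -/

import Mathlib

open Finset SimpleGraph

/-- A neighbor-sum-distinguishing proper total `k`-coloring of `G`:
vertex colors `cv` and edge colors `ce` taken from `{1, …, k}`, proper on
vertices, edges, and incidences, and distinguishing adjacent vertices by the
total sum of colors at each vertex. -/
def IsProperTotalColoring {V : Type*} [Fintype V] (G : SimpleGraph V) (k : ℕ)
    (cv : V → ℕ) (ce : Sym2 V → ℕ) : Prop :=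
  (∀ v, cv v ∈ Finset.Icc 1 k) ∧
  (∀ u v, G.Adj u v → ce s(u, v) ∈ Finset.Icc 1 k) ∧
  (∀ u v, G.Adj u v → cv u ≠ cv v) ∧
  (∀ u v w, G.Adj u v → G.Adj u w → v ≠ w → ce s(u, v) ≠ ce s(u, w)) ∧
  (∀ u v, G.Adj u v → ce s(u, v) ≠ cv u ∧ ce s(u, v) ≠ cv v)

open Classical in
/-- The total color-sum at a vertex: the color of `v` plus the colors of all
edges incident with `v`. -/
noncomputable def totalSum {V : Type*} [Fintype V] (G : SimpleGraph V)
    (cv : V → ℕ) (ce : Sym2 V → ℕ) (v : V) : ℕ :=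
  cv v + ∑ w ∈ Finset.univ.filter (fun w => G.Adj v w), ce s(v, w)

/-- A neighbor-sum-distinguishing proper total `k`-coloring. -/
def IsNSDColoring {V : Type*} [Fintype V] (G : SimpleGraph V) (k : ℕ)
    (cv : V → ℕ) (ce : Sym2 V → ℕ) : Prop :=
  IsProperTotalColoring G k cv ce ∧
  ∀ u v, G.Adj u v → totalSum G cv ce u ≠ totalSum G cv ce v

/-- `tndi G` is the least `k` such that `G` admits a neighbor-sum-distinguishing
proper total `k`-coloring. -/
noncomputable def tndi {V : Type*} [Fintype V] (G : SimpleGraph V) : ℕ :=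
  sInf {k | ∃ cv ce, IsNSDColoring G k cv ce}

/-- The maximum degree of a finite simple graph. -/
noncomputable def maxDeg {V : Type*} [Fintype V] (G : SimpleGraph V) : ℕ :=
  @SimpleGraph.maxDegree V G _ (Classical.decRel _)

/-- The star `S_n = K_{1,n}` with center `0` and `n` leaves. -/
def starGraph (n : ℕ) : SimpleGraph (Fin (n + 1)) :=
  SimpleGraph.fromRel fun i _ => i = 0

/-- The wheel `W_m`: hub `0` joined to every vertex of the cycle on `1, …, m`. -/
def wheelGraph (m : ℕ) : SimpleGraph (Fin (m + 1)) :=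
  SimpleGraph.fromRel fun i j =>
    i = 0 ∨ (j.val = i.val + 1 ∧ 2 ≤ j.val) ∨ (i.val = m ∧ j.val = 1)

namespace PrismColoring

/-- The prism over the cycle on `n + 3` vertices. -/
abbrev prism (n : ℕ) : SimpleGraph (Fin (n + 3) × Fin 2) :=
  (cycleGraph (n + 3)).boxProd (pathGraph 2)

lemma add_one_ne_self {n : ℕ} (i : Fin (n + 3)) : i + 1 ≠ i := by
  simp

lemma add_one_add_one_ne_self {n : ℕ} (i : Fin (n + 3)) : i + 1 + 1 ≠ i := by
  rw [add_assoc, Ne, add_eq_left, Fin.ext_iff, Fin.val_add, Fin.val_one', Fin.val_zero,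
    Nat.mod_eq_of_lt (show 1 < n + 3 by omega), Nat.mod_eq_of_lt (by omega)]
  simp

lemma prism_adj {n : ℕ} {i j : Fin (n + 3)} {a b : Fin 2} :
    (prism n).Adj (i, a) (j, b) ↔ (j = i + 1 ∨ i = j + 1) ∧ a = b ∨ i = j ∧ a ≠ b := by
  have hcycle : (cycleGraph (n + 3)).Adj i j ↔ (j = i + 1 ∨ i = j + 1) := by
    rw [cycleGraph_adj, sub_eq_iff_eq_add', sub_eq_iff_eq_add', or_comm]
  have hpath : (pathGraph 2).Adj a b ↔ a ≠ b := by
    rw [pathGraph_adj]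
    omega
  rw [boxProd_adj, hcycle, hpath]
  tauto

open Classical in
lemma filter_prism_adj {n : ℕ} (i : Fin (n + 3)) (a : Fin 2) :
    Finset.univ.filter (fun w => (prism n).Adj (i + 1, a) w) =
      {(i, a), (i + 1 + 1, a), (i + 1, a + 1)} := by
  ext ⟨j, b⟩
  simp only [mem_filter, mem_univ, true_and, prism_adj, mem_insert, mem_singleton, Prod.mk.injEq,
    add_left_inj]
  have : a ≠ b ↔ b = a + 1 := by omega
  rw [this, eq_comm (a := a), eq_comm (a := i), eq_comm (a := i + 1) (b := j)]
  tauto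

lemma sum_prism_adj {n : ℕ} (i : Fin (n + 3)) (a : Fin 2) (f : Fin (n + 3) × Fin 2 → ℕ) :
    ∑ w ∈ ({(i, a), (i + 1 + 1, a), (i + 1, a + 1)} : Finset (Fin (n + 3) × Fin 2)), f w =
      f (i, a) + f (i + 1 + 1, a) + f (i + 1, a + 1) := by
  have h1 := add_one_ne_self i
  have h2 := add_one_add_one_ne_self i
  have h3 := add_one_ne_self (i + 1)
  rw [sum_insert, sum_insert, sum_singleton, ← add_assoc]
  · simp [h3]
  · simp [h1.symm, h2.symm]

lemma totalSum_prism {n : ℕ} (cv : Fin (n + 3) × Fin 2 → ℕ) (ce : Sym2 (Fin (n + 3) × Fin 2) → ℕ)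
    (i : Fin (n + 3)) (a : Fin 2) :
    totalSum (prism n) cv ce (i + 1, a) =
      cv (i + 1, a) + (ce s((i + 1, a), (i, a)) + ce s((i + 1, a), (i + 1 + 1, a)) +
        ce s((i + 1, a), (i + 1, a + 1))) := by
  rw [totalSum, filter_prism_adj, sum_prism_adj]

lemma maxDeg_prism (n : ℕ) : maxDeg (prism n) = 3 := by
  classical
  have hdeg : ∀ v [Fintype ((prism n).neighborSet v)], (prism n).degree v = 3 := by
    rintro ⟨i, a⟩ _
    obtain ⟨i, rfl⟩ : ∃ j, i = j + 1 := ⟨i - 1, by simp⟩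
    have hnbr : (prism n).neighborFinset (i + 1, a) =
        {(i, a), (i + 1 + 1, a), (i + 1, a + 1)} := by
      rw [← filter_prism_adj]
      ext w
      rw [mem_neighborFinset, mem_filter_univ]
    rw [← card_neighborFinset_eq_degree, hnbr, card_eq_sum_ones, sum_prism_adj]
  rw [maxDeg]
  let := Classical.decRel (prism n).Adj
  have hle := degree_le_maxDegree (prism n) (0, 0)
  rw [hdeg] at hle
  refine le_antisymm (maxDegree_le_of_forall_degree_le _ _ fun v => ?_) ?_
  · rw [hdeg]
  · exact hle

/-- With at most four colors every vertex sum of a proper total coloring of the prism is `10`. -/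
lemma totalSum_eq_ten {n k : ℕ} {cv : Fin (n + 3) × Fin 2 → ℕ}
    {ce : Sym2 (Fin (n + 3) × Fin 2) → ℕ} (h : IsProperTotalColoring (prism n) k cv ce)
    (hk : k ≤ 4) (i : Fin (n + 3)) (a : Fin 2) : totalSum (prism n) cv ce (i + 1, a) = 10 := by
  obtain ⟨hcv, hce, -, hee, hev⟩ := h
  have ha : a ≠ a + 1 := by omega
  have a1 : (prism n).Adj (i + 1, a) (i, a) := prism_adj.2 (by simp)
  have a2 : (prism n).Adj (i + 1, a) (i + 1 + 1, a) := prism_adj.2 (by simp)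
  have a3 : (prism n).Adj (i + 1, a) (i + 1, a + 1) := prism_adj.2 (by simp [ha])
  have h12 := hee _ _ _ a1 a2 (by simpa using (add_one_add_one_ne_self i).symm)
  have h13 := hee _ _ _ a1 a3 (by simp)
  have h23 := hee _ _ _ a2 a3 (by simp)
  have h1 := (hev _ _ a1).1
  have h2 := (hev _ _ a2).1
  have h3 := (hev _ _ a3).1
  have b0 := mem_Icc.1 (hcv (i + 1, a))
  have b1 := mem_Icc.1 (hce _ _ a1)
  have b2 := mem_Icc.1 (hce _ _ a2)
  have b3 := mem_Icc.1 (hce _ _ a3)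
  rw [totalSum_prism]
  omega

lemma five_le_of_isNSDColoring {n k : ℕ} {cv : Fin (n + 3) × Fin 2 → ℕ}
    {ce : Sym2 (Fin (n + 3) × Fin 2) → ℕ} (h : IsNSDColoring (prism n) k cv ce) : 5 ≤ k := by
  by_contra! hk
  refine h.2 (0 + 1, 0) (0 + 1, 1) (prism_adj.2 (by simp)) ?_
  rw [totalSum_eq_ten h.1 (by omega), totalSum_eq_ten h.1 (by omega)]

/-- Colors around one rung of a prism: the horizontal edges to the left and to the right of the
rung (the same colors in both rows), the rung, and its two endpoints. -/
structure Column where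
  left : ℕ
  right : ℕ
  rung : ℕ
  vertex : Fin 2 → ℕ

/-- The colors of a column lie in `{1, …, 5}` and are proper at its rung. -/
def Column.IsValid (s : Column) : Prop :=
  s.left ∈ Finset.Icc 1 5 ∧ s.right ∈ Finset.Icc 1 5 ∧ s.rung ∈ Finset.Icc 1 5 ∧
  s.left ≠ s.right ∧ s.left ≠ s.rung ∧ s.right ≠ s.rung ∧ s.vertex 0 ≠ s.vertex 1 ∧
  ∀ a, s.vertex a ∈ Finset.Icc 1 5 ∧ s.vertex a ≠ s.left ∧ s.vertex a ≠ s.right ∧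
    s.vertex a ≠ s.rung

/-- The column `t` may follow the column `s` immediately to its right. -/
def Column.Follows (t s : Column) : Prop :=
  s.right = t.left ∧ ∀ a, s.vertex a ≠ t.vertex a ∧
    s.vertex a + s.left + s.right + s.rung ≠ t.vertex a + t.left + t.right + t.rung

/-- The edge colors of a prism determined by a sequence of columns. -/
def edgeColor {n : ℕ} (w : Fin (n + 3) → Column) : Sym2 (Fin (n + 3) × Fin 2) → ℕ :=
  Sym2.lift ⟨fun u v => if u.1 = v.1 then (w u.1).rung else
    if v.1 = u.1 + 1 then (w u.1).right else if u.1 = v.1 + 1 then (w v.1).right else 0, by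
      rintro ⟨i, a⟩ ⟨j, b⟩
      have := add_one_add_one_ne_self i
      grind⟩

lemma edgeColor_rung {n : ℕ} (w : Fin (n + 3) → Column) (i : Fin (n + 3)) (a b : Fin 2) :
    edgeColor w s((i, a), (i, b)) = (w i).rung := by
  simp [edgeColor]

lemma edgeColor_right {n : ℕ} (w : Fin (n + 3) → Column) (i : Fin (n + 3)) (a b : Fin 2) :
    edgeColor w s((i, a), (i + 1, b)) = (w i).right := by
  simp [edgeColor]

lemma edgeColor_left {n : ℕ} (w : Fin (n + 3) → Column) (i : Fin (n + 3)) (a b : Fin 2) :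
    edgeColor w s((i + 1, a), (i, b)) = (w i).right := by
  rw [Sym2.eq_swap, edgeColor_right]

lemma isNSDColoring_of_columns {n : ℕ} (w : Fin (n + 3) → Column) (hw : ∀ i, (w i).IsValid)
    (hs : ∀ i, (w (i + 1)).Follows (w i)) :
    IsNSDColoring (prism n) 5 (fun v => (w v.1).vertex v.2) (edgeColor w) := by
  have hrow : ∀ i (a b : Fin 2), a ≠ b → (w i).vertex a ≠ (w i).vertex b := by
    intro i a b hab
    have := (hw i).2.2.2.2.2.2.1
    fin_cases a <;> fin_cases b <;> simp_all [eq_comm]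
  have hsum : ∀ i a, totalSum (prism n) (fun v => (w v.1).vertex v.2) (edgeColor w) (i, a) =
      (w i).vertex a + (w i).left + (w i).right + (w i).rung := by
    intro i a
    obtain ⟨i, rfl⟩ : ∃ j, i = j + 1 := ⟨i - 1, by simp⟩
    rw [totalSum_prism, edgeColor_left, edgeColor_right, edgeColor_rung, (hs i).1]
    ring
  refine ⟨⟨fun v => ((hw v.1).2.2.2.2.2.2.2 v.2).1, ?_, ?_, ?_, ?_⟩, ?_⟩
  · rintro ⟨i, a⟩ ⟨j, b⟩ h
    rcases prism_adj.1 h with ⟨rfl | rfl, -⟩ | ⟨rfl, -⟩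
    · rw [edgeColor_right]; exact (hw _).2.1
    · rw [edgeColor_left]; exact (hw _).2.1
    · rw [edgeColor_rung]; exact (hw _).2.2.1
  · rintro ⟨i, a⟩ ⟨j, b⟩ h
    rcases prism_adj.1 h with ⟨rfl | rfl, rfl⟩ | ⟨rfl, hab⟩
    · exact ((hs _).2 _).1
    · exact ((hs _).2 _).1.symm
    · exact hrow _ _ _ hab
  · rintro ⟨i, a⟩ ⟨j, b⟩ ⟨k, c⟩ h h' hne
    obtain ⟨-, -, -, hlr, hlg, hrg, -⟩ := hw i
    rcases prism_adj.1 h with ⟨rfl | rfl, rfl⟩ | ⟨rfl, hab⟩ <;>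
      rcases prism_adj.1 h' with ⟨hk | hk, hac⟩ | ⟨hk, hac⟩
    · simp_all
    · subst hk
      rw [edgeColor_right, edgeColor_left, (hs k).1]
      exact hlr.symm
    · subst hk
      rw [edgeColor_right, edgeColor_rung]
      exact hrg
    · subst hk
      rw [edgeColor_right, edgeColor_left, (hs j).1]
      exact hlr
    · simp_all
    · subst hk
      rw [edgeColor_left, edgeColor_rung, (hs j).1]
      exact hlg
    · subst hk
      rw [edgeColor_right, edgeColor_rung]
      exact hrg.symm
    · subst hk
      rw [edgeColor_left, edgeColor_rung, (hs k).1]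
      exact hlg.symm
    · exact absurd (Prod.ext hk (show b = c by omega)) hne
  · rintro ⟨i, a⟩ ⟨j, b⟩ h
    obtain ⟨-, -, -, -, -, -, -, hvi⟩ := hw i
    obtain ⟨-, -, -, -, -, -, -, hvj⟩ := hw j
    rcases prism_adj.1 h with ⟨rfl | rfl, rfl⟩ | ⟨rfl, hab⟩
    · rw [edgeColor_right]
      exact ⟨(hvi a).2.2.1.symm, (hs i).1.trans_ne (hvj a).2.1.symm⟩
    · rw [edgeColor_left]
      exact ⟨(hs j).1.trans_ne (hvi a).2.1.symm, (hvj a).2.2.1.symm⟩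
    · rw [edgeColor_rung]
      exact ⟨(hvi a).2.2.2.symm, (hvi b).2.2.2.symm⟩
  · rintro ⟨i, a⟩ ⟨j, b⟩ h
    rw [hsum, hsum]
    rcases prism_adj.1 h with ⟨rfl | rfl, rfl⟩ | ⟨rfl, hab⟩
    · exact ((hs _).2 _).2
    · exact ((hs _).2 _).2.symm
    · have := hrow i a b hab
      omega

/-- The first column of every coloring. -/
def baseColumn : Column := ⟨2, 3, 1, ![4, 5]⟩

/-- From `baseColumn`, a closed walk of any length at least two along valid columns. -/
lemma exists_columns (m : ℕ) : ∃ w : ℕ → Column, w 0 = baseColumn ∧ w (m + 2) = baseColumn ∧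
    (∀ i, (w i).IsValid) ∧ ∀ i < m + 2, (w (i + 1)).Follows (w i) := by
  have hbase : baseColumn.IsValid := by
    simp [baseColumn, Column.IsValid, Fin.forall_fin_two]
  induction m using Nat.twoStepInduction with
  | zero =>
    refine ⟨fun i => if i = 1 then ⟨3, 2, 1, ![5, 4]⟩ else baseColumn, rfl, rfl, ?_, ?_⟩
    · intro i
      dsimp only
      split_ifs
      · simp [Column.IsValid, Fin.forall_fin_two]
      · exact hbase
    · intro i hi
      interval_cases i <;> simp [baseColumn, Column.Follows, Fin.forall_fin_two]
  | one =>
    refine ⟨fun i => if i = 1 then ⟨3, 4, 1, ![5, 2]⟩ else if i = 2 then ⟨4, 2, 5, ![1, 3]⟩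
      else baseColumn, rfl, rfl, ?_, ?_⟩
    · intro i
      dsimp only
      split_ifs
      · simp [Column.IsValid, Fin.forall_fin_two]
      · simp [Column.IsValid, Fin.forall_fin_two]
      · exact hbase
    · intro i hi
      interval_cases i <;> simp [baseColumn, Column.Follows, Fin.forall_fin_two]
  | more m ih _ =>
    obtain ⟨w, h0, hm, hv, hf⟩ := ih
    refine ⟨fun i => if i = 0 then baseColumn else if i = 1 then ⟨3, 2, 1, ![5, 4]⟩
      else w (i - 2), rfl, by simpa using hm, ?_, ?_⟩
    · intro i
      dsimp only
      split_ifs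
      · exact hbase
      · simp [Column.IsValid, Fin.forall_fin_two]
      · exact hv _
    · rintro (_ | _ | i) hi
      · simp [baseColumn, Column.Follows, Fin.forall_fin_two]
      · simp [h0, baseColumn, Column.Follows, Fin.forall_fin_two]
      · simpa using hf i (by omega)

lemma exists_isNSDColoring (n : ℕ) : ∃ cv ce, IsNSDColoring (prism n) 5 cv ce := by
  obtain ⟨w, h0, hm, hv, hf⟩ := exists_columns (n + 1)
  refine ⟨_, _, isNSDColoring_of_columns (fun i => w i) (fun i => hv i) fun i => ?_⟩
  have := hf i i.isLt
  rw [Fin.val_add_one]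
  split_ifs with hi
  · rw [hi, Fin.val_last, hm, ← h0] at this
    rwa [hi, Fin.val_last]
  · exact this

lemma tndi_prism (n : ℕ) : tndi (prism n) = 5 :=
  IsLeast.csInf_eq ⟨exists_isNSDColoring n, fun _ ⟨_, _, h⟩ => five_le_of_isNSDColoring h⟩

end PrismColoring

theorem stmt_14 (m : ℕ) (hm : 3 ≤ m) :
    maxDeg ((cycleGraph m).boxProd (pathGraph 2)) = 3 ∧
    tndi ((cycleGraph m).boxProd (pathGraph 2)) = 5 := by
  obtain ⟨n, rfl⟩ := Nat.exists_eq_add_of_le' hm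
  exact ⟨PrismColoring.maxDeg_prism n, PrismColoring.tndi_prism n⟩
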